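/- arXiv:2008.07479 — 3 statements merged into one kernel-verified Lean document; each statement's English description precedes it below -/
import Mathlib

section
/- Let k be a field and A an associative commutative unital k-algebra. Assume A contains elements x_1, …, x_n that are algebraically independent over k and generate A as a k-algebra. If y_1, …, y_m ∈ A generate A as a k-algebra, then m ≥ n. -/
/-- Let `k` be a field and `A` an associative commutative unital `k`-algebra containing
algebraically independent generators `x 0, …, x (n-1)`.  If `y 0, …, y (m-1)` generate `A`
as a `k`-algebra, then `m ≥ n`. -/
theorem generators_card_ge_of_algIndep_generators
    (k A : Type*) [Field k] [CommRing A] [Algebra k A] (n m : ℕ)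
    (x : Fin n → A) (hx_ind : AlgebraicIndependent k x)
    (hx_gen : Algebra.adjoin k (Set.range x) = ⊤)
    (y : Fin m → A) (hy_gen : Algebra.adjoin k (Set.range y) = ⊤) :
    m ≥ n := by
  have hsurj : Function.Surjective (MvPolynomial.aeval y : MvPolynomial (Fin m) k →ₐ[k] A) := by
    rw [← AlgHom.range_eq_top, ← Algebra.adjoin_range_eq_range_aeval, hy_gen]
  have h1 := lift_trdeg_le_of_surjective _ hsurj
  have h2 := hx_ind.lift_cardinalMk_le_trdeg
  rw [MvPolynomial.trdeg_of_isDomain] at h1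
  have h3 : Algebra.trdeg k A ≤ (m : Cardinal) := by simpa using h1
  have h4 : (n : Cardinal) ≤ Algebra.trdeg k A := by simpa using h2
  exact_mod_cast h4.trans h3
end

section
/- Let k be a field and A an associative commutative unital k-algebra. Assume A contains elements x_1, …, x_n that are algebraically independent over k and generate A as a k-algebra. If y_1, …, y_n ∈ A generate A as a k-algebra, then y_1, …, y_n are algebraically independent over k. -/
/-- Let `k` be a field and `A` an associative commutative unital `k`-algebra containing
algebraically independent generators `x 0, …, x (n-1)`.  If `y 0, …, y (n-1)` generate `A`
as a `k`-algebra, then `y 0, …, y (n-1)` are algebraically independent over `k`. -/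
theorem algIndep_of_generators_card_eq
    (k A : Type*) [Field k] [CommRing A] [Algebra k A] (n : ℕ)
    (x : Fin n → A) (hx_ind : AlgebraicIndependent k x)
    (hx_gen : Algebra.adjoin k (Set.range x) = ⊤)
    (y : Fin n → A) (hy_gen : Algebra.adjoin k (Set.range y) = ⊤) :
    AlgebraicIndependent k y := by
  have hs : Function.Surjective (MvPolynomial.aeval (R := k) x) := by
    rw [← AlgHom.range_eq_top, ← Algebra.adjoin_range_eq_range_aeval, hx_gen]
  have e : MvPolynomial (Fin n) k ≃ₐ[k] A := AlgEquiv.ofBijective _ ⟨hx_ind, hs⟩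
  have : IsDomain A := e.symm.toMulEquiv.isDomain _
  have : Algebra.IsAlgebraic (Algebra.adjoin k (Set.range y)) A := by
    refine ⟨fun a => ?_⟩
    have ha : a ∈ Algebra.adjoin k (Set.range y) := by rw [hy_gen]; trivial
    exact isAlgebraic_algebraMap (⟨a, ha⟩ : Algebra.adjoin k (Set.range y))
  exact (Algebra.IsAlgebraic.isTranscendenceBasis_of_lift_le_trdeg_of_finite k y
    hx_ind.lift_cardinalMk_le_trdeg).1
end

section
/- Let k be a field. If there exists a surjective k-algebra homomorphism φ : k[Y_1,…,Y_m] → k[X_1,…,X_n] between polynomial rings over k, then m ≥ n. -/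
/-- If there is a surjective `k`-algebra homomorphism `k[Y_1,…,Y_m] → k[X_1,…,X_n]`
between polynomial rings over a field `k`, then `m ≥ n`. -/
theorem mvPolynomial_surjective_algHom_card_ge
    (k : Type*) [Field k] (n m : ℕ)
    (φ : MvPolynomial (Fin m) k →ₐ[k] MvPolynomial (Fin n) k)
    (hφ : Function.Surjective φ) :
    m ≥ n := by
  have h := ringKrullDim_le_of_surjective (φ : MvPolynomial (Fin m) k →+* MvPolynomial (Fin n) k) hφ
  rw [MvPolynomial.ringKrullDim_of_isNoetherianRing, MvPolynomial.ringKrullDim_of_isNoetherianRing,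
    ringKrullDim_eq_zero_of_field, zero_add, zero_add, Nat.card_fin, Nat.card_fin] at h
  exact_mod_cast h
end
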